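/- For every complex q with |q| < 1: ∑_{n≥0} q^{2n}/(1 − q^{5n+1}) − ∑_{n≥0} q^{3n+2}/(1 − q^{5n+4}) = (q^5, q^5; q^5)_∞ / (q, q^4; q^5)_∞. -/

import Mathlib

/-!
Common definitions: for a partition `π` of `n`,
`numParts` is the number of parts, `largestPart` the largest part,
`omegaOnes` the number of parts equal to 1, `rank` and `crank` the
Dyson rank and Andrews–Garvan crank.  `NT m j n` is the total number of
parts over partitions of `n` with rank ≡ m (mod j), and `Mw m j n` is
the total number of ones over partitions of `n` with crank ≡ m (mod j).
`poch a q = (a; q)_∞ = ∏_{n ≥ 0} (1 - a qⁿ)`.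
-/

namespace Beck

/-- number of parts of a partition -/
def numParts {n : ℕ} (π : n.Partition) : ℕ := Multiset.card π.parts

/-- largest part of a partition (0 for the empty partition) -/
def largestPart {n : ℕ} (π : n.Partition) : ℕ := π.parts.sup

/-- number of ones in a partition -/
def omegaOnes {n : ℕ} (π : n.Partition) : ℕ := π.parts.count 1

/-- number of parts strictly larger than the number of ones -/
def muParts {n : ℕ} (π : n.Partition) : ℕ :=
  Multiset.card (π.parts.filter fun x => omegaOnes π < x)

/-- Dyson's rank: largest part minus number of parts -/
def rank {n : ℕ} (π : n.Partition) : ℤ :=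
  (largestPart π : ℤ) - (numParts π : ℤ)

/-- the Andrews–Garvan crank -/
def crank {n : ℕ} (π : n.Partition) : ℤ :=
  if omegaOnes π = 0 then (largestPart π : ℤ)
  else (muParts π : ℤ) - (omegaOnes π : ℤ)

/-- `NT m j n`: total number of parts in partitions of `n` with rank ≡ m (mod j) -/
def NT (m j n : ℕ) : ℤ :=
  ∑ π : n.Partition,
    if rank π % (j : ℤ) = (m : ℤ) % (j : ℤ) then (numParts π : ℤ) else 0

/-- `Mw m j n`: total number of ones in partitions of `n` with crank ≡ m (mod j) -/
def Mw (m j n : ℕ) : ℤ :=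
  ∑ π : n.Partition,
    if crank π % (j : ℤ) = (m : ℤ) % (j : ℤ) then (omegaOnes π : ℤ) else 0

/-- `(a; q)_∞ = ∏_{n ≥ 0} (1 - a qⁿ)` -/
noncomputable def poch (a q : ℂ) : ℂ := ∏' n : ℕ, (1 - a * q ^ n)

open Finset Filter Topology

/-- The finite `q`-Pochhammer product `(a; p)_n = ∏_{k < n} (1 - a p^k)`. -/
def finPoch {K : Type*} [Field K] (a p : K) (n : ℕ) : K := ∏ k ∈ range n, (1 - a * p ^ k)

section Field
variable {K : Type*} [Field K]

theorem prod_pow_sub_low (p c d : K) (hd : d ≠ 0) (n : ℕ) :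
    ∏ k ∈ range n, (p ^ n * c - d * p ^ k)
      = (-d) ^ n * (∏ k ∈ range n, p ^ k) * finPoch (p * c / d) p n := by
  have h : (-d) ^ n = ∏ _k ∈ range n, -d := by rw [prod_const, card_range]
  rw [← prod_range_reflect, ← prod_range_reflect (fun k => p ^ k), finPoch, h,
    ← prod_mul_distrib, ← prod_mul_distrib]
  refine prod_congr rfl fun k hk => ?_
  have hk := mem_range.mp hk
  obtain ⟨j, rfl⟩ : ∃ j, n = j + 1 + k := ⟨n - 1 - k, by omega⟩
  have : j + 1 + k - 1 - k = j := by omega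
  rw [this]
  field_simp
  ring

theorem prod_pow_sub_high (p c d : K) (hc : c ≠ 0) (n m b : ℕ) :
    ∏ k ∈ range b, (p ^ n * c - d * p ^ (n + m + k))
      = (p ^ n * c) ^ b * finPoch (d * p ^ m / c) p b := by
  rw [finPoch, ← card_range b, ← prod_const, card_range, ← prod_mul_distrib]
  refine prod_congr rfl fun k _ => ?_
  field_simp
  ring

theorem prod_erase_range {M : Type*} [CommMonoid M] (f : ℕ → M) (i b : ℕ) :
    ∏ k ∈ (range (i + 1 + b)).erase i, f k
      = (∏ k ∈ range i, f k) * ∏ k ∈ range b, f (i + 1 + k) := by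
  have h : ∏ k ∈ (range (i + 1 + b)).erase i, f k
      = ∏ k ∈ (range (i + 1 + b)).erase i, Function.update f i 1 k :=
    prod_congr rfl fun k hk => by rw [Function.update_of_ne (ne_of_mem_erase hk)]
  rw [h, prod_erase _ (by simp), prod_range_add, prod_range_succ, Function.update_self, mul_one]
  congr 1
  · exact prod_congr rfl fun k hk => by
      rw [Function.update_of_ne (mem_range.mp hk).ne]
  · exact prod_congr rfl fun k _ => by rw [Function.update_of_ne (by omega)]

theorem residue_eq (p x : K) (hp : p ≠ 0) (hx : x ≠ 0) (i b : ℕ) :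
    (∏ k ∈ (range (i + 1 + b)).erase i, (p ^ i - p ^ k)⁻¹)
        * ∏ k ∈ range (i + b), (p ^ i - x * p ^ k)
      = x ^ i * (finPoch (p / x) p i / finPoch p p i * (finPoch x p b / finPoch p p b)) := by
  have h1 := prod_pow_sub_low p 1 x hx i
  have h2 := prod_pow_sub_low p 1 1 one_ne_zero i
  have h3 := prod_pow_sub_high p 1 x one_ne_zero i 0 b
  have h4 := prod_pow_sub_high p 1 1 one_ne_zero i 1 b
  simp only [mul_one, one_mul, div_one, pow_one, add_zero, pow_zero] at h1 h2 h3 h4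
  rw [prod_inv_distrib, prod_erase_range, prod_range_add, h1, h2, h3, h4]
  have h5 : ∏ k ∈ range i, p ^ k ≠ 0 := prod_ne_zero_iff.mpr fun k _ => pow_ne_zero k hp
  have h6 : (-x) ^ i = (-1) ^ i * x ^ i := by rw [neg_pow]
  have h7 : ((-1 : K)) ^ i ≠ 0 := pow_ne_zero _ (by simp)
  have h8 : (p ^ i) ^ b ≠ 0 := pow_ne_zero _ (pow_ne_zero _ hp)
  rw [h6]
  generalize (-1 : K) ^ i = s at *
  generalize (p ^ i) ^ b = t at *
  generalize ∏ k ∈ range i, p ^ k = r at *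
  rw [mul_inv, mul_inv, mul_inv, mul_inv]
  simp only [div_eq_mul_inv]
  calc _ = (s * s⁻¹) * (t * t⁻¹) * (r * r⁻¹) * (x ^ i * (finPoch (p * x⁻¹) p i *
        (finPoch p p i)⁻¹ * (finPoch x p b * (finPoch p p b)⁻¹))) := by ring
    _ = _ := by rw [mul_inv_cancel₀ h7, mul_inv_cancel₀ h8, mul_inv_cancel₀ h5]; ring

/-- Partial fractions at the nodes `p^i`. -/
theorem partial_fractions (p x w : K) (hp : p ≠ 0) (hx : x ≠ 0)
    (hinj : Function.Injective fun n : ℕ => p ^ n) (hw : ∀ n : ℕ, w ≠ p ^ n) (M : ℕ) :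
    (∏ k ∈ range M, (w - x * p ^ k)) / ∏ k ∈ range (M + 1), (w - p ^ k)
      = ∑ i ∈ range (M + 1), x ^ i * (finPoch (p / x) p i / finPoch p p i *
          (finPoch x p (M - i) / finPoch p p (M - i))) / (w - p ^ i) := by
  classical
  let f : Polynomial K := ∏ k ∈ range M, (Polynomial.X - Polynomial.C (x * p ^ k))
  have hev (z : K) : f.eval z = ∏ k ∈ range M, (z - x * p ^ k) := by
    simp [f, Polynomial.eval_prod]
  have hdeg : f.degree < (range (M + 1)).card := by
    rw [Polynomial.degree_prod_of_monic _ _ fun k _ => Polynomial.monic_X_sub_C _]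
    simp only [Polynomial.degree_X_sub_C, sum_const, card_range, nsmul_eq_mul, mul_one]
    exact_mod_cast Nat.lt_succ_self M
  have hi := Lagrange.eq_interpolate (v := fun n : ℕ => p ^ n) hinj.injOn hdeg
  have hz := Lagrange.eval_interpolate_not_at_node (s := range (M + 1))
    (v := fun n : ℕ => p ^ n) (fun i => f.eval (p ^ i)) (x := w) fun i _ => hw i
  rw [← hi, hev, Lagrange.eval_nodal] at hz
  have hne : ∏ k ∈ range (M + 1), (w - p ^ k) ≠ 0 :=
    prod_ne_zero_iff.mpr fun k _ => sub_ne_zero.mpr (hw k)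
  rw [hz, mul_div_cancel_left₀ _ hne]
  refine sum_congr rfl fun i hi => ?_
  obtain ⟨b, rfl⟩ : ∃ b, M = i + b := ⟨M - i, by have := mem_range.mp hi; omega⟩
  rw [Nat.add_sub_cancel_left, ← residue_eq p x hp hx, hev, Lagrange.nodalWeight,
    show i + b + 1 = i + 1 + b by ring]
  ring

/-- A finite form of Ramanujan's bilateral summation of `∑ x^n / (1 - y p^n)`. -/
theorem finite_bilateral_sum (p x y : K) (hp : p ≠ 0) (hx : x ≠ 0) (hy : y ≠ 0)
    (hinj : Function.Injective fun n : ℕ => p ^ n) (h1 : ∀ n : ℕ, 1 - y * p ^ n ≠ 0)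
    (h2 : ∀ n : ℕ, y - p ^ (n + 1) ≠ 0) (N : ℕ) :
    finPoch (p / (x * y)) p N * finPoch (x * y) p N / (finPoch (p / y) p N * finPoch y p (N + 1))
      = ∑ n ∈ range (N + 1), x ^ n / (1 - y * p ^ n) *
          (finPoch (p / x) p (N + n) / finPoch p p (N + n) *
            (finPoch x p (N - n) / finPoch p p (N - n)))
        - ∑ n ∈ range N, (p / x) ^ (n + 1) / (y - p ^ (n + 1)) *
          (finPoch (p / x) p (N - 1 - n) / finPoch p p (N - 1 - n) *
            (finPoch x p (N + 1 + n) / finPoch p p (N + 1 + n))) := by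
  have hw (n : ℕ) : p ^ N * (1 / y) ≠ p ^ n := by
    intro h
    have h' : p ^ N = p ^ n * y := by field_simp at h; rw [h, mul_comm]
    rcases lt_or_ge n N with hn | hn
    · obtain ⟨k, rfl⟩ : ∃ k, N = n + (k + 1) := ⟨N - n - 1, by omega⟩
      rw [pow_add] at h'
      exact h2 k (sub_eq_zero.mpr (mul_left_cancel₀ (pow_ne_zero n hp) h').symm)
    · obtain ⟨k, rfl⟩ := Nat.exists_eq_add_of_le hn
      rw [pow_add, mul_assoc] at h'
      refine h1 k (sub_eq_zero.mpr (mul_left_cancel₀ (pow_ne_zero N hp) ?_))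
      rw [mul_one, mul_comm y, ← h']
  have hpN : p ^ N ≠ 0 := pow_ne_zero _ hp
  have hxN : x ^ N ≠ 0 := pow_ne_zero _ hx
  have key := partial_fractions p x (p ^ N * (1 / y)) hp hx hinj hw (N + N)
  have hL : (∏ k ∈ range (N + N), (p ^ N * (1 / y) - x * p ^ k)) /
      ∏ k ∈ range (N + N + 1), (p ^ N * (1 / y) - p ^ k)
      = x ^ N * (y / p ^ N) * (finPoch (p / (x * y)) p N * finPoch (x * y) p N /
          (finPoch (p / y) p N * finPoch y p (N + 1))) := by
    have e1 := prod_pow_sub_low p (1 / y) x hx N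
    have e2 := prod_pow_sub_low p (1 / y) 1 one_ne_zero N
    have e3 := prod_pow_sub_high p (1 / y) x (one_div_ne_zero hy) N 0 N
    have e4 := prod_pow_sub_high p (1 / y) 1 (one_div_ne_zero hy) N 0 (N + 1)
    rw [show p * (1 / y) / x = p / (x * y) by field_simp] at e1
    rw [show p * (1 / y) / 1 = p / y by field_simp] at e2
    rw [show x * p ^ 0 / (1 / y) = x * y by field_simp] at e3
    rw [show 1 * p ^ 0 / (1 / y) = y by field_simp] at e4
    simp only [one_mul, add_zero] at e2 e3 e4
    rw [add_assoc N N 1, prod_range_add, prod_range_add, e1, e2, e3, e4, pow_succ _ N,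
      neg_pow x]
    have h5 : ∏ k ∈ range N, p ^ k ≠ 0 := prod_ne_zero_iff.mpr fun k _ => pow_ne_zero k hp
    have h7 : (-1 : K) ^ N ≠ 0 := pow_ne_zero _ (by simp)
    have h8 : (p ^ N * (1 / y)) ^ N ≠ 0 := pow_ne_zero _ (mul_ne_zero hpN (one_div_ne_zero hy))
    generalize (-1 : K) ^ N = s at *
    generalize (p ^ N * (1 / y)) ^ N = t at *
    generalize ∏ k ∈ range N, p ^ k = r at *
    simp only [div_eq_mul_inv, mul_inv, inv_inv, one_mul]
    generalize finPoch y p (N + 1) = a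
    calc _ = (s * s⁻¹) * (t * t⁻¹) * (r * r⁻¹) * (x ^ N * (y * (p ^ N)⁻¹) *
          (finPoch (p * (x⁻¹ * y⁻¹)) p N * finPoch (x * y) p N *
            ((finPoch (p * y⁻¹) p N)⁻¹ * a⁻¹))) := by ring
      _ = _ := by rw [mul_inv_cancel₀ h7, mul_inv_cancel₀ h8, mul_inv_cancel₀ h5]; ring
  have hc : x ^ N * (y / p ^ N) ≠ 0 := mul_ne_zero hxN (div_ne_zero hy hpN)
  refine mul_left_cancel₀ hc ?_
  rw [← hL, key, add_assoc N N 1, sum_range_add, ← sum_range_reflect _ N, mul_sub, mul_sum,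
    mul_sum, add_comm, sub_eq_add_neg, ← sum_neg_distrib]
  congr 1
  · refine sum_congr rfl fun n hn => ?_
    rw [show N + N - (N + n) = N - n by omega, pow_add x,
      show p ^ N * (1 / y) - p ^ (N + n) = p ^ N / y * (1 - y * p ^ n) by field_simp; ring]
    have := h1 n
    field_simp
  · refine sum_congr rfl fun n hn => ?_
    have hn := mem_range.mp hn
    obtain ⟨j, rfl⟩ : ∃ j, N = j + (n + 1) := ⟨N - 1 - n, by omega⟩
    rw [show j + (n + 1) - 1 - n = j by omega,
      show j + (n + 1) + (j + (n + 1)) - j = j + (n + 1) + 1 + n by omega,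
      show p ^ (j + (n + 1)) * (1 / y) - p ^ j = -(p ^ j / y * (y - p ^ (n + 1))) by
        field_simp; ring, pow_add p, pow_add x, div_pow]
    have := h2 n
    generalize finPoch (p / x) p j / finPoch p p j *
      (finPoch x p (j + (n + 1) + 1 + n) / finPoch p p (j + (n + 1) + 1 + n)) = a
    field_simp
    ring

end Field

theorem tendsto_sum_range_mul (F : ℕ → ℂ) (hF : Summable fun n => ‖F n‖) (c : ℕ → ℕ → ℂ) (C : ℝ)
    (hC : ∀ N n, ‖c N n‖ ≤ C) (L : ℂ) (hL : ∀ n, Tendsto (fun N => c N n) atTop (𝓝 L))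
    (k : ℕ → ℕ) (hk : Tendsto k atTop atTop) :
    Tendsto (fun N => ∑ n ∈ range (k N), F n * c N n) atTop (𝓝 ((∑' n, F n) * L)) := by
  rw [← tsum_mul_right]
  have h : (fun N => ∑ n ∈ range (k N), F n * c N n)
      = fun N => ∑' n, if n < k N then F n * c N n else 0 := by
    funext N
    rw [tsum_eq_sum (s := range (k N)) (fun n hn => if_neg (by simpa using hn))]
    exact sum_congr rfl fun n hn => (if_pos (mem_range.mp hn)).symm
  rw [h]
  refine tendsto_tsum_of_dominated_convergence (bound := fun n => ‖F n‖ * C) (hF.mul_right C) ?_ ?_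
  · intro n
    refine ((hL n).const_mul (F n)).congr' ?_
    filter_upwards [hk.eventually_gt_atTop n] with N hN
    rw [if_pos hN]
  · refine Eventually.of_forall fun N n => ?_
    have hC0 : 0 ≤ C := (norm_nonneg _).trans (hC 0 0)
    split_ifs
    · rw [norm_mul]; gcongr; exact hC N n
    · rw [norm_zero]; positivity

theorem summable_norm_mul_pow (a p : ℂ) (hp : ‖p‖ < 1) : Summable fun n : ℕ => ‖-(a * p ^ n)‖ := by
  simpa [norm_mul, norm_pow] using
    (summable_geometric_of_lt_one (norm_nonneg p) hp).mul_left ‖a‖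

theorem tendsto_finPoch (a p : ℂ) (hp : ‖p‖ < 1) :
    Tendsto (finPoch a p) atTop (𝓝 (∏' n : ℕ, (1 - a * p ^ n))) := by
  have h := multipliable_one_add_of_summable (summable_norm_mul_pow a p hp)
  have h' := h.hasProd.tendsto_prod_nat
  simp only [← sub_eq_add_neg] at h'
  exact h'

theorem tprod_one_sub_ne_zero (a p : ℂ) (ha : ‖a‖ < 1) (hp : ‖p‖ < 1) :
    ∏' n : ℕ, (1 - a * p ^ n) ≠ 0 := by
  have h := tprod_one_add_ne_zero_of_summable (f := fun n : ℕ => -(a * p ^ n)) (fun n h => ?_)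
    (summable_norm_mul_pow a p hp)
  · simpa [← sub_eq_add_neg] using h
  · have h1 : a * p ^ n = 1 := by linear_combination -h
    have h2 : ‖a * p ^ n‖ < 1 := by
      rw [norm_mul, norm_pow]
      exact mul_lt_one_of_nonneg_of_lt_one_left (norm_nonneg _) ha
        (pow_le_one₀ (norm_nonneg _) hp.le)
    rw [h1] at h2
    simp at h2

theorem one_sub_pow_ne_zero {q : ℂ} (hq : ‖q‖ < 1) {n : ℕ} (hn : n ≠ 0) : 1 - q ^ n ≠ 0 := by
  intro h
  have h1 : ‖q ^ n‖ < 1 := by rw [norm_pow]; exact pow_lt_one₀ (norm_nonneg _) hq hn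
  rw [← sub_eq_zero.mp h] at h1
  simp at h1

theorem summable_norm_lambert (q : ℂ) (hq : ‖q‖ < 1) (a b c d : ℕ) (ha : a ≠ 0) (hd : d ≠ 0) :
    Summable fun n : ℕ => ‖q ^ (a * n + b) / (1 - q ^ (c * n + d))‖ := by
  have h0 : 0 < 1 - ‖q‖ := sub_pos.mpr hq
  refine Summable.of_nonneg_of_le (fun _ => norm_nonneg _) (fun n => ?_)
    ((summable_geometric_of_lt_one (norm_nonneg q) hq).div_const (1 - ‖q‖))
  rw [norm_div, norm_pow]
  refine div_le_div₀ (by positivity) (pow_le_pow_of_le_one (norm_nonneg _) hq.le ?_) h0 ?_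
  · have := Nat.le_mul_of_pos_left n (Nat.pos_of_ne_zero ha)
    omega
  · have h1 : ‖q ^ (c * n + d)‖ ≤ ‖q‖ := by
      rw [norm_pow]
      exact pow_le_of_le_one (norm_nonneg _) hq.le (by omega)
    have h2 := norm_sub_norm_le (1 : ℂ) (q ^ (c * n + d))
    rw [norm_one] at h2
    linarith

theorem pow_injective_of_norm_lt_one {p : ℂ} (hp0 : p ≠ 0) (hp : ‖p‖ < 1) :
    Function.Injective fun n : ℕ => p ^ n := by
  intro m n h
  have hnorm : ‖p‖ ^ m = ‖p‖ ^ n := by simpa using congrArg norm h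
  exact (pow_right_strictAnti₀ (norm_pos_iff.mpr hp0) hp).injective hnorm

/-- Identity (2.10):
`∑_{n≥0} q^{2n}/(1 − q^{5n+1}) − ∑_{n≥0} q^{3n+2}/(1 − q^{5n+4})
  = (q⁵, q⁵; q⁵)_∞ / (q, q⁴; q⁵)_∞` for `|q| < 1`. -/
theorem statement_13 (q : ℂ) (hq : ‖q‖ < 1) :
    (∑' n : ℕ, q ^ (2 * n) / (1 - q ^ (5 * n + 1)))
      - ∑' n : ℕ, q ^ (3 * n + 2) / (1 - q ^ (5 * n + 4))
    = (poch (q ^ 5) (q ^ 5) * poch (q ^ 5) (q ^ 5))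
      / (poch q (q ^ 5) * poch (q ^ 4) (q ^ 5)) := by
  rcases eq_or_ne q 0 with rfl | hq0
  · rw [tsum_eq_single 0 fun n hn => by simp [hn]]
    simp [poch]
  have hpow {k : ℕ} (hk : k ≠ 0) : ‖q ^ k‖ < 1 := by
    rw [norm_pow]; exact pow_lt_one₀ (norm_nonneg _) hq hk
  have hp : ‖q ^ 5‖ < 1 := hpow (by norm_num)
  have hp0 : q ^ 5 ≠ 0 := pow_ne_zero _ hq0
  have hlim (a : ℂ) : Tendsto (finPoch a (q ^ 5)) atTop (𝓝 (poch a (q ^ 5))) :=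
    tendsto_finPoch a _ hp
  have hne {k : ℕ} (hk : k ≠ 0) : poch (q ^ k) (q ^ 5) ≠ 0 :=
    tprod_one_sub_ne_zero _ _ (hpow hk) hp
  have hne1 : poch q (q ^ 5) ≠ 0 := tprod_one_sub_ne_zero _ _ hq hp
  have hne2 := hne (k := 2) (by norm_num)
  have hne3 := hne (k := 3) (by norm_num)
  have hne4 := hne (k := 4) (by norm_num)
  have hne5 := hne (k := 5) (by norm_num)
  have hα := (hlim (q ^ 3)).div (hlim (q ^ 5)) hne5
  have hβ := (hlim (q ^ 2)).div (hlim (q ^ 5)) hne5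
  obtain ⟨A, hA⟩ := (Metric.isBounded_range_of_tendsto _ hα).exists_norm_le
  obtain ⟨B, hB⟩ := (Metric.isBounded_range_of_tendsto _ hβ).exists_norm_le
  have hA0 : 0 ≤ A := (norm_nonneg _).trans (hA _ ⟨0, rfl⟩)
  have hbound (m n : ℕ) : ‖finPoch (q ^ 3) (q ^ 5) m / finPoch (q ^ 5) (q ^ 5) m *
      (finPoch (q ^ 2) (q ^ 5) n / finPoch (q ^ 5) (q ^ 5) n)‖ ≤ A * B := by
    rw [norm_mul]
    exact mul_le_mul (hA _ ⟨m, rfl⟩) (hB _ ⟨n, rfl⟩) (norm_nonneg _) hA0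
  have hsum1 := summable_norm_lambert q hq 2 0 5 1 (by norm_num) (by norm_num)
  have hsum2 := summable_norm_lambert q hq 3 2 5 4 (by norm_num) (by norm_num)
  have hadd (n : ℕ) : Tendsto (fun N => N + n) atTop atTop := tendsto_add_atTop_nat n
  have hsub (n : ℕ) : Tendsto (fun N => N - n) atTop atTop := tendsto_sub_atTop_nat n
  have hT1 := tendsto_sum_range_mul _ hsum1 _ _ (fun N n => hbound (N + n) (N - n)) _
    (fun n => (hα.comp (hadd n)).mul (hβ.comp (hsub n))) (fun N => N + 1) (hadd 1)
  have hT2 := tendsto_sum_range_mul _ hsum2 _ _ (fun N n => hbound (N - 1 - n) (N + 1 + n)) _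
    (fun n => (hα.comp ((hsub n).comp (hsub 1))).mul (hβ.comp ((hadd n).comp (hadd 1))))
    (fun N => N) tendsto_id
  have hL := ((hlim (q ^ 2)).mul (hlim (q ^ 3))).div
    ((hlim (q ^ 4)).mul ((hlim q).comp (hadd 1))) (mul_ne_zero hne4 hne1)
  have hfin (N : ℕ) := finite_bilateral_sum (q ^ 5) (q ^ 2) q hp0 (pow_ne_zero _ hq0) hq0
    (pow_injective_of_norm_lt_one hp0 hp)
    (fun n => by
      rw [← pow_mul, ← pow_succ']
      exact one_sub_pow_ne_zero hq (by omega))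
    (fun n => by
      rw [← pow_mul, show q - q ^ (5 * (n + 1)) = q * (1 - q ^ (5 * n + 4)) by ring]
      exact mul_ne_zero hq0 (one_sub_pow_ne_zero hq (by omega))) N
  rw [show q ^ 5 / (q ^ 2 * q) = q ^ 2 by field_simp, show q ^ 2 * q = q ^ 3 by ring,
    show q ^ 5 / q = q ^ 4 by field_simp, show q ^ 5 / q ^ 2 = q ^ 3 by field_simp] at hfin
  have hterm1 (n : ℕ) : (q ^ 2) ^ n / (1 - q * (q ^ 5) ^ n)
      = q ^ (2 * n + 0) / (1 - q ^ (5 * n + 1)) := by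
    rw [← pow_mul, ← pow_mul, ← pow_succ', add_zero]
  have hterm2 (n : ℕ) : (q ^ 3) ^ (n + 1) / (q - (q ^ 5) ^ (n + 1))
      = q ^ (3 * n + 2) / (1 - q ^ (5 * n + 4)) := by
    rw [show (q ^ 3) ^ (n + 1) = q * q ^ (3 * n + 2) by ring,
      show q - (q ^ 5) ^ (n + 1) = q * (1 - q ^ (5 * n + 4)) by ring,
      mul_div_mul_left _ _ hq0]
  simp only [hterm1, hterm2] at hfin
  have key := tendsto_nhds_unique (hL.congr hfin) (hT1.sub hT2)
  simp only [add_zero] at key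
  rw [← sub_mul] at key
  generalize (∑' n : ℕ, q ^ (2 * n) / (1 - q ^ (5 * n + 1)))
      - ∑' n : ℕ, q ^ (3 * n + 2) / (1 - q ^ (5 * n + 4)) = S at key ⊢
  field_simp at key ⊢
  linear_combination -key

end Beck
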